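/- Let Ω ⊂ ℝ^n be a bounded open set and let V ∈ C_0^∞(Ω) be real-valued. Then (4π)^{n/2} Σ_{α^2} c_{α^2} P_{α^2}(V) = -(1/12) ∫_Ω |∇V(x)|² dx, where the sum runs over all pairs α^2 = (α_1, α_2) of multi-indices in ℕ^n with |α_1| + |α_2| = 2. -/

import Mathlib

open MeasureTheory Real

noncomputable def heatG (n : ℕ) (t : ℝ) (x : EuclideanSpace ℝ (Fin n)) : ℝ :=
  (4 * Real.pi * t) ^ (-(n : ℝ) / 2) * Real.exp (-‖x‖ ^ 2 / (4 * t))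

/-- The simplex `{0 < s_m < … < s_1 < 1}` (indices listed in decreasing order). -/
def simplex (m : ℕ) : Set (Fin m → ℝ) :=
  {s | StrictAnti s ∧ ∀ k, s k ∈ Set.Ioo (0 : ℝ) 1}

/-- `fnext s k = s (k+1)`, with the convention that it is `0` past the last index. -/
def fnext {m : ℕ} {E : Type*} [Zero E] (s : Fin m → E) (k : Fin m) : E :=
  if h : (k : ℕ) + 1 < m then s ⟨(k : ℕ) + 1, h⟩ else 0

/-- The coefficient `c_{αʲ}` associated with a `(j+1)`-tuple `α` of multi-indices in `ℕⁿ`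
(a tuple of length `j+1`, so that tuples of every length `≥ 1` are covered). -/
noncomputable def cCoeff (n j : ℕ) (α : Fin (j + 1) → Fin n → ℕ) : ℝ :=
  (∏ k, ∏ i, (Nat.factorial (α k i) : ℝ))⁻¹ *
    ∫ w : Fin (j + 1) → EuclideanSpace ℝ (Fin n),
      ∫ s in simplex (j + 1),
        (∏ k, ∏ i, w k i ^ α k i) *
          (heatG n (1 - s 0) (w 0) *
            ∏ k, heatG n (s k - fnext s k) (w k - fnext w k))

/-- Partial derivative in the `i`-th coordinate direction. -/
noncomputable def pderiv1 {n : ℕ} (i : Fin n) (f : EuclideanSpace ℝ (Fin n) → ℝ) :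
    EuclideanSpace ℝ (Fin n) → ℝ :=
  fun x => fderiv ℝ f x (EuclideanSpace.single i 1)

/-- The multi-index partial derivative `∂^α f`. -/
noncomputable def mderiv {n : ℕ} (α : Fin n → ℕ) (f : EuclideanSpace ℝ (Fin n) → ℝ) :
    EuclideanSpace ℝ (Fin n) → ℝ :=
  ((List.ofFn fun i : Fin n => (pderiv1 i)^[α i]).foldr (· ∘ ·) id) f

/-- `P_{αʲ}(V) = ∫_Ω ∏_k ∂^{α_k} V`. -/
noncomputable def Pcoef (n j : ℕ) (Ω : Set (EuclideanSpace ℝ (Fin n)))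
    (α : Fin (j + 1) → Fin n → ℕ) (V : EuclideanSpace ℝ (Fin n) → ℝ) : ℝ :=
  ∫ x in Ω, ∏ k, mderiv (α k) V x

section GaussianMoments

open ProbabilityTheory

theorem integrable_pow_mul_gaussianPDFReal (m : ℕ) {v : NNReal} (hv : v ≠ 0) :
    Integrable (fun x : ℝ => x ^ m * gaussianPDFReal 0 v x) := by
  have h1 : Integrable (fun x : ℝ => x ^ m) (gaussianReal 0 v) := by
    have h := (memLp_id_gaussianReal (μ := 0) (v := v) (m : NNReal))
    have h2 : Integrable (fun x : ℝ => ‖x‖ ^ m) (gaussianReal 0 v) := by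
      simpa using h.integrable_norm_pow'
    refine h2.mono' (by fun_prop) (Filter.Eventually.of_forall fun x => ?_)
    simp
  rw [gaussianReal_of_var_ne_zero 0 hv,
    integrable_withDensity_iff_integrable_smul' (measurable_gaussianPDF 0 v)
      (Filter.Eventually.of_forall fun x => gaussianPDF_lt_top)] at h1
  refine h1.congr (Filter.Eventually.of_forall fun x => ?_)
  simp [toReal_gaussianPDF, mul_comm]

theorem integral_mul_gaussianPDFReal {v : NNReal} (hv : v ≠ 0) :
    ∫ x : ℝ, x * gaussianPDFReal 0 v x = 0 := by
  have h := integral_id_gaussianReal (μ := 0) (v := v)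
  rw [integral_gaussianReal_eq_integral_smul hv] at h
  simpa [mul_comm] using h

theorem integral_sq_mul_gaussianPDFReal {v : NNReal} (hv : v ≠ 0) :
    ∫ x : ℝ, x ^ 2 * gaussianPDFReal 0 v x = v := by
  have h := variance_fun_id_gaussianReal (μ := 0) (v := v)
  rw [variance_eq_integral (by fun_prop), integral_id_gaussianReal,
    integral_gaussianReal_eq_integral_smul hv] at h
  simpa [mul_comm] using h

theorem heatG_eq_prod_gaussianPDFReal {n : ℕ} {t : ℝ} (ht : 0 < t)
    (x : EuclideanSpace ℝ (Fin n)) :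
    heatG n t x = ∏ i, gaussianPDFReal 0 (2 * t).toNNReal (x i) := by
  have h0 : 0 < 4 * π * t := by positivity
  simp only [gaussianPDFReal, Finset.prod_mul_distrib, Finset.prod_const, Finset.card_univ,
    Fintype.card_fin, ← Real.exp_sum, heatG, EuclideanSpace.norm_sq_eq]
  have ht2 : ((2 * t).toNNReal : ℝ) = 2 * t := Real.coe_toNNReal _ (by positivity)
  rw [ht2]
  congr 1
  · rw [show 2 * π * (2 * t) = 4 * π * t by ring, Real.sqrt_eq_rpow, ← Real.rpow_neg h0.le,
      ← Real.rpow_mul_natCast h0.le]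
    congr 1
    ring
  · congr 1
    rw [← Finset.sum_div, Finset.sum_neg_distrib]
    simp only [sub_zero, Real.norm_eq_abs, sq_abs]
    congr 1
    ring

theorem pow_mul_heatG_eq_prod {n : ℕ} {t : ℝ} (ht : 0 < t) (i : Fin n) (m : ℕ)
    (x : EuclideanSpace ℝ (Fin n)) :
    x i ^ m * heatG n t x =
      ∏ j, (x j ^ (if j = i then m else 0) * gaussianPDFReal 0 (2 * t).toNNReal (x j)) := by
  rw [Finset.prod_mul_distrib, heatG_eq_prod_gaussianPDFReal ht]
  congr 1
  rw [Finset.prod_eq_single i] <;> simp +contextual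

theorem two_mul_toNNReal_ne_zero {t : ℝ} (ht : 0 < t) : (2 * t).toNNReal ≠ 0 := by
  simpa using ht

theorem integrable_pow_mul_heatG {n : ℕ} {t : ℝ} (ht : 0 < t) (i : Fin n) (m : ℕ) :
    Integrable (fun x : EuclideanSpace ℝ (Fin n) => x i ^ m * heatG n t x) := by
  simp only [pow_mul_heatG_eq_prod ht]
  rw [← (PiLp.volume_preserving_toLp (Fin n)).integrable_comp_emb
    (MeasurableEquiv.toLp 2 (Fin n → ℝ)).measurableEmbedding]
  exact Integrable.fintype_prod_dep
    (f := fun j y => y ^ (if j = i then m else 0) * gaussianPDFReal 0 (2 * t).toNNReal y)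
    fun j => integrable_pow_mul_gaussianPDFReal _ (two_mul_toNNReal_ne_zero ht)

theorem integral_pow_mul_heatG {n : ℕ} {t : ℝ} (ht : 0 < t) (i : Fin n) (m : ℕ) :
    ∫ x : EuclideanSpace ℝ (Fin n), x i ^ m * heatG n t x =
      ∫ y : ℝ, y ^ m * gaussianPDFReal 0 (2 * t).toNNReal y := by
  simp only [pow_mul_heatG_eq_prod ht]
  rw [← (PiLp.volume_preserving_toLp (Fin n)).integral_comp
    (MeasurableEquiv.toLp 2 (Fin n → ℝ)).measurableEmbedding]
  simp only []
  rw [integral_fintype_prod_volume_eq_prod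
    (fun j y => y ^ (if j = i then m else 0) * gaussianPDFReal 0 (2 * t).toNNReal y),
    Finset.prod_eq_single i]
  · simp
  · intro j _ hj
    simp [hj, integral_gaussianPDFReal_eq_one 0 (two_mul_toNNReal_ne_zero ht)]
  · simp

theorem integral_heatG {n : ℕ} {t : ℝ} (ht : 0 < t) (i : Fin n) :
    ∫ x : EuclideanSpace ℝ (Fin n), heatG n t x = 1 := by
  simpa [integral_gaussianPDFReal_eq_one 0 (two_mul_toNNReal_ne_zero ht)] using
    integral_pow_mul_heatG ht i 0

theorem integral_coord_mul_heatG {n : ℕ} {t : ℝ} (ht : 0 < t) (i : Fin n) :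
    ∫ x : EuclideanSpace ℝ (Fin n), x i * heatG n t x = 0 := by
  simpa [integral_mul_gaussianPDFReal (two_mul_toNNReal_ne_zero ht)] using
    integral_pow_mul_heatG ht i 1

theorem integral_coord_sq_mul_heatG {n : ℕ} {t : ℝ} (ht : 0 < t) (i : Fin n) :
    ∫ x : EuclideanSpace ℝ (Fin n), x i ^ 2 * heatG n t x = 2 * t := by
  rw [integral_pow_mul_heatG ht, integral_sq_mul_gaussianPDFReal (two_mul_toNNReal_ne_zero ht),
    Real.coe_toNNReal _ (by positivity)]

/-- Second moments of a pair of independent Gaussian vectors. -/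
theorem integrable_and_integral_bilin_heatG {n : ℕ} {p q : ℝ} (hp : 0 < p) (hq : 0 < q)
    (i : Fin n) (a b a' b' : ℝ) :
    Integrable (fun z : EuclideanSpace ℝ (Fin n) × EuclideanSpace ℝ (Fin n) =>
      (a * z.1 i + b * z.2 i) * (a' * z.1 i + b' * z.2 i) * (heatG n p z.1 * heatG n q z.2)) ∧
    ∫ z : EuclideanSpace ℝ (Fin n) × EuclideanSpace ℝ (Fin n),
      (a * z.1 i + b * z.2 i) * (a' * z.1 i + b' * z.2 i) * (heatG n p z.1 * heatG n q z.2) =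
      a * a' * (2 * p) + b * b' * (2 * q) := by
  have hp0 := integrable_pow_mul_heatG hp i 0
  have hp1 := integrable_pow_mul_heatG hp i 1
  have hp2 := integrable_pow_mul_heatG hp i 2
  have hq0 := integrable_pow_mul_heatG hq i 0
  have hq1 := integrable_pow_mul_heatG hq i 1
  have hq2 := integrable_pow_mul_heatG hq i 2
  have e : (fun z : EuclideanSpace ℝ (Fin n) × EuclideanSpace ℝ (Fin n) =>
      (a * z.1 i + b * z.2 i) * (a' * z.1 i + b' * z.2 i) * (heatG n p z.1 * heatG n q z.2)) =
      fun z => (a * a') * ((z.1 i ^ 2 * heatG n p z.1) * (z.2 i ^ 0 * heatG n q z.2)) +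
        (a * b' + b * a') * ((z.1 i ^ 1 * heatG n p z.1) * (z.2 i ^ 1 * heatG n q z.2)) +
        (b * b') * ((z.1 i ^ 0 * heatG n p z.1) * (z.2 i ^ 2 * heatG n q z.2)) := by
    funext z
    ring
  have i1 := (hp2.mul_prod hq0).const_mul (a * a')
  have i2 := (hp1.mul_prod hq1).const_mul (a * b' + b * a')
  have i3 := (hp0.mul_prod hq2).const_mul (b * b')
  rw [e]
  refine ⟨(i1.fun_add i2).fun_add i3, ?_⟩
  rw [Measure.volume_eq_prod, integral_add (i1.fun_add i2) i3, integral_add i1 i2,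
    integral_const_mul, integral_const_mul, integral_const_mul,
    integral_prod_mul (fun x : EuclideanSpace ℝ (Fin n) => x i ^ 2 * heatG n p x)
      (fun x : EuclideanSpace ℝ (Fin n) => x i ^ 0 * heatG n q x),
    integral_prod_mul (fun x : EuclideanSpace ℝ (Fin n) => x i ^ 1 * heatG n p x)
      (fun x : EuclideanSpace ℝ (Fin n) => x i ^ 1 * heatG n q x),
    integral_prod_mul (fun x : EuclideanSpace ℝ (Fin n) => x i ^ 0 * heatG n p x)
      (fun x : EuclideanSpace ℝ (Fin n) => x i ^ 2 * heatG n q x)]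
  simp only [pow_zero, pow_one, one_mul, integral_heatG hp i, integral_heatG hq i,
    integral_coord_mul_heatG hp, integral_coord_mul_heatG hq, integral_coord_sq_mul_heatG hp,
    integral_coord_sq_mul_heatG hq]
  ring

end GaussianMoments

section BridgeKernel

/-- The three-fold product of heat kernels along a path `0 → w₁ → w₀ → 0` in unit time. -/
noncomputable def bridgeKernel (n : ℕ) (s : Fin 2 → ℝ) (w : Fin 2 → EuclideanSpace ℝ (Fin n)) :
    ℝ :=
  heatG n (1 - s 0) (w 0) * (heatG n (s 0 - s 1) (w 0 - w 1) * heatG n (s 1) (w 1))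

theorem heatG_mul_prod_fnext (n : ℕ) (s : Fin 2 → ℝ) (w : Fin 2 → EuclideanSpace ℝ (Fin n)) :
    heatG n (1 - s 0) (w 0) * ∏ k, heatG n (s k - fnext s k) (w k - fnext w k) =
      bridgeKernel n s w := by
  simp [bridgeKernel, Fin.prod_univ_two, fnext]

theorem mem_simplex_two {s : Fin 2 → ℝ} : s ∈ simplex 2 ↔ 0 < s 1 ∧ s 1 < s 0 ∧ s 0 < 1 := by
  simp only [simplex, Set.mem_ofPred_eq, Fin.forall_fin_two, Set.mem_Ioo, Fin.strictAnti_iff_succ_lt]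
  simp
  constructor
  · rintro ⟨h1, ⟨h2, h3⟩, h4, h5⟩
    exact ⟨h4, h1, h3⟩
  · rintro ⟨h1, h2, h3⟩
    exact ⟨h2, ⟨h1.trans h2, h3⟩, h1, h2.trans h3⟩

theorem heatG_nonneg {n : ℕ} {t : ℝ} (ht : 0 < t) (x : EuclideanSpace ℝ (Fin n)) :
    0 ≤ heatG n t x := by
  unfold heatG
  positivity

theorem bridgeKernel_nonneg {n : ℕ} {s : Fin 2 → ℝ} (hs : s ∈ simplex 2)
    (w : Fin 2 → EuclideanSpace ℝ (Fin n)) : 0 ≤ bridgeKernel n s w := by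
  obtain ⟨h1, h2, h3⟩ := mem_simplex_two.1 hs
  exact mul_nonneg (heatG_nonneg (by linarith) _)
    (mul_nonneg (heatG_nonneg (by linarith) _) (heatG_nonneg h1 _))

theorem measurable_uncurry_heatG (n : ℕ) :
    Measurable fun z : ℝ × EuclideanSpace ℝ (Fin n) => heatG n z.1 z.2 := by
  unfold heatG
  fun_prop

theorem measurable_bridgeKernel (n : ℕ) :
    Measurable fun z : (Fin 2 → EuclideanSpace ℝ (Fin n)) × (Fin 2 → ℝ) =>
      bridgeKernel n z.2 z.1 := by
  have h := measurable_uncurry_heatG n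
  exact (h.comp (f := fun z : (Fin 2 → EuclideanSpace ℝ (Fin n)) × (Fin 2 → ℝ) =>
      (1 - z.2 0, z.1 0)) (by fun_prop)).mul
    ((h.comp (f := fun z : (Fin 2 → EuclideanSpace ℝ (Fin n)) × (Fin 2 → ℝ) =>
      (z.2 0 - z.2 1, z.1 0 - z.1 1)) (by fun_prop)).mul
      (h.comp (f := fun z : (Fin 2 → EuclideanSpace ℝ (Fin n)) × (Fin 2 → ℝ) =>
      (z.2 1, z.1 1)) (by fun_prop)))

/-- Completing the square: the Gaussian bridge has an autoregressive representation. -/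
theorem bridgeKernel_eq {n : ℕ} {s : Fin 2 → ℝ} (hs : s ∈ simplex 2)
    (w : Fin 2 → EuclideanSpace ℝ (Fin n)) :
    bridgeKernel n s w = (4 * π) ^ (-(n : ℝ) / 2) *
      (heatG n (s 0 * (1 - s 0)) (w 0) *
        heatG n ((s 0 - s 1) * s 1 / s 0) (w 1 - (s 1 / s 0) • w 0)) := by
  obtain ⟨h1, h2, h3⟩ := mem_simplex_two.1 hs
  have h0 : 0 < s 0 := h1.trans h2
  have ha : 0 < 1 - s 0 := by linarith
  have hb : 0 < s 0 - s 1 := by linarith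
  have hπ : 0 < 4 * π := by positivity
  simp only [bridgeKernel, heatG]
  have hpow : (4 * π * (1 - s 0)) ^ (-(n : ℝ) / 2) * ((4 * π * (s 0 - s 1)) ^ (-(n : ℝ) / 2) *
      (4 * π * s 1) ^ (-(n : ℝ) / 2)) = (4 * π) ^ (-(n : ℝ) / 2) *
      ((4 * π * (s 0 * (1 - s 0))) ^ (-(n : ℝ) / 2) *
      (4 * π * ((s 0 - s 1) * s 1 / s 0)) ^ (-(n : ℝ) / 2)) := by
    have hq : 0 < (s 0 - s 1) * s 1 / s 0 := by positivity
    rw [← Real.mul_rpow (by positivity) (by positivity),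
      ← Real.mul_rpow (by positivity) (by positivity),
      ← Real.mul_rpow (by positivity) (by positivity),
      ← Real.mul_rpow (by positivity) (by positivity)]
    congr 1
    field_simp
  have hexp : rexp (-‖w 0‖ ^ 2 / (4 * (1 - s 0))) * (rexp (-‖w 0 - w 1‖ ^ 2 / (4 * (s 0 - s 1))) *
      rexp (-‖w 1‖ ^ 2 / (4 * s 1))) = rexp (-‖w 0‖ ^ 2 / (4 * (s 0 * (1 - s 0)))) *
      rexp (-‖w 1 - (s 1 / s 0) • w 0‖ ^ 2 / (4 * ((s 0 - s 1) * s 1 / s 0))) := by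
    rw [← Real.exp_add, ← Real.exp_add, ← Real.exp_add, norm_sub_sq_real, norm_sub_sq_real,
      inner_smul_right, norm_smul, mul_pow, Real.norm_eq_abs, sq_abs, real_inner_comm (w 0) (w 1)]
    congr 1
    have hb' := hb.ne'
    have ha' := ha.ne'
    field_simp
    ring
  linear_combination (rexp (-‖w 0‖ ^ 2 / (4 * (1 - s 0))) *
    (rexp (-‖w 0 - w 1‖ ^ 2 / (4 * (s 0 - s 1))) * rexp (-‖w 1‖ ^ 2 / (4 * s 1)))) * hpow +
    (4 * π) ^ (-(n : ℝ) / 2) * ((4 * π * (s 0 * (1 - s 0))) ^ (-(n : ℝ) / 2) *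
      (4 * π * ((s 0 - s 1) * s 1 / s 0)) ^ (-(n : ℝ) / 2)) * hexp

/-- Twice the covariance `min(s_k, s_l) (1 - max(s_k, s_l))` of a Brownian bridge on `[0, 1]`. -/
noncomputable def bridgeCov (s : Fin 2 → ℝ) (k l : Fin 2) : ℝ :=
  2 * (s (max k l) * (1 - s (min k l)))

theorem integrable_and_integral_mul_bridgeKernel {n : ℕ} {s : Fin 2 → ℝ} (hs : s ∈ simplex 2)
    (i : Fin n) (k l : Fin 2) :
    Integrable (fun w : Fin 2 → EuclideanSpace ℝ (Fin n) => w k i * w l i * bridgeKernel n s w) ∧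
    ∫ w : Fin 2 → EuclideanSpace ℝ (Fin n), w k i * w l i * bridgeKernel n s w =
      (4 * π) ^ (-(n : ℝ) / 2) * bridgeCov s k l := by
  obtain ⟨h1, h2, h3⟩ := mem_simplex_two.1 hs
  have h0 : 0 < s 0 := h1.trans h2
  have ha : 0 < 1 - s 0 := by linarith
  have hb : 0 < s 0 - s 1 := by linarith
  have hp : 0 < s 0 * (1 - s 0) := by positivity
  have hq : 0 < (s 0 - s 1) * s 1 / s 0 := by positivity
  set r := s 1 / s 0 with hr
  let A : Fin 2 → ℝ := ![1, r]
  let B : Fin 2 → ℝ := ![0, 1]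
  obtain ⟨hint, hval⟩ := integrable_and_integral_bilin_heatG hp hq i (A k) (B k) (A l) (B l)
  let Φ : (Fin 2 → EuclideanSpace ℝ (Fin n)) →
      EuclideanSpace ℝ (Fin n) × EuclideanSpace ℝ (Fin n) := fun w => (w 0, w 1 - r • w 0)
  have hshear : MeasurePreserving
      (fun z : EuclideanSpace ℝ (Fin n) × EuclideanSpace ℝ (Fin n) => (z.1, z.2 - r • z.1)) :=
    (MeasurePreserving.id volume).skew_product (g := fun x y => y - r • x) (by fun_prop)
      (Filter.Eventually.of_forall fun x => map_sub_right_eq_self volume (r • x))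
  have hΦ : MeasurePreserving Φ :=
    hshear.comp (volume_preserving_finTwoArrow (EuclideanSpace ℝ (Fin n)))
  have hΦe : MeasurableEmbedding Φ := by
    refine Continuous.measurableEmbedding (by fun_prop) fun w w' h => ?_
    simp only [Φ, Prod.mk.injEq] at h
    funext m
    fin_cases m
    · exact h.1
    · have := h.2
      rw [h.1] at this
      simpa using this
  have e : (fun w : Fin 2 → EuclideanSpace ℝ (Fin n) => w k i * w l i * bridgeKernel n s w) =
      fun w => (4 * π) ^ (-(n : ℝ) / 2) *
        ((fun z : EuclideanSpace ℝ (Fin n) × EuclideanSpace ℝ (Fin n) =>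
          (A k * z.1 i + B k * z.2 i) * (A l * z.1 i + B l * z.2 i) *
          (heatG n (s 0 * (1 - s 0)) z.1 * heatG n ((s 0 - s 1) * s 1 / s 0) z.2)) (Φ w)) := by
    funext w
    have hw : ∀ m : Fin 2, w m i = A m * (Φ w).1 i + B m * (Φ w).2 i := by
      intro m
      fin_cases m <;> simp [A, B, Φ]
    rw [bridgeKernel_eq hs, hw k, hw l]
    ring
  rw [e]
  refine ⟨(hΦ.integrable_comp_of_integrable hint).const_mul _, ?_⟩
  rw [integral_const_mul]
  refine congrArg _ ((hΦ.integral_comp hΦe _).trans (hval.trans ?_))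
  fin_cases k <;> fin_cases l <;> simp [A, B, bridgeCov, hr] <;> field_simp
  ring

end BridgeKernel

section Coefficients

theorem measurableSet_simplex_two : MeasurableSet (simplex 2) := by
  have : simplex 2 = {s | 0 < s 1} ∩ ({s | s 1 < s 0} ∩ {s | s 0 < 1}) := by
    ext s
    exact mem_simplex_two
  rw [this]
  exact (measurableSet_lt (by fun_prop) (by fun_prop)).inter
    ((measurableSet_lt (by fun_prop) (by fun_prop)).inter
      (measurableSet_lt (by fun_prop) (by fun_prop)))

theorem isBounded_simplex_two : Bornology.IsBounded (simplex 2) := by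
  refine (Metric.isBounded_Icc (0 : Fin 2 → ℝ) 1).subset fun s hs => ?_
  exact ⟨fun k => (hs.2 k).1.le, fun k => (hs.2 k).2.le⟩

theorem integrableOn_simplex_two {f : (Fin 2 → ℝ) → ℝ} (hf : Continuous f) :
    IntegrableOn f (simplex 2) :=
  (hf.continuousOn.integrableOn_compact isBounded_simplex_two.isCompact_closure).mono_set
    subset_closure

theorem continuous_bridgeCov (k l : Fin 2) : Continuous fun s => bridgeCov s k l := by
  unfold bridgeCov
  fun_prop

theorem measurable_mul_bridgeKernel (n : ℕ) (i : Fin n) (k l : Fin 2) :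
    Measurable fun z : (Fin 2 → EuclideanSpace ℝ (Fin n)) × (Fin 2 → ℝ) =>
      z.1 k i * z.1 l i * bridgeKernel n z.2 z.1 :=
  Measurable.mul (by fun_prop) (measurable_bridgeKernel n)

theorem integrable_sq_mul_bridgeKernel_prod (n : ℕ) (i : Fin n) (k : Fin 2) :
    Integrable (fun z : (Fin 2 → EuclideanSpace ℝ (Fin n)) × (Fin 2 → ℝ) =>
      z.1 k i * z.1 k i * bridgeKernel n z.2 z.1)
      (volume.prod (volume.restrict (simplex 2))) := by
  rw [integrable_prod_iff' (measurable_mul_bridgeKernel n i k k).aestronglyMeasurable]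
  constructor
  · filter_upwards [ae_restrict_mem measurableSet_simplex_two] with s hs
    exact (integrable_and_integral_mul_bridgeKernel hs i k k).1
  · refine ((integrableOn_simplex_two (continuous_bridgeCov k k)).const_mul
      ((4 * π) ^ (-(n : ℝ) / 2))).congr ?_
    filter_upwards [ae_restrict_mem measurableSet_simplex_two] with s hs
    rw [← (integrable_and_integral_mul_bridgeKernel hs i k k).2]
    refine integral_congr_ae (Filter.Eventually.of_forall fun w => ?_)
    exact (Real.norm_of_nonneg (mul_nonneg (mul_self_nonneg _) (bridgeKernel_nonneg hs w))).symm

theorem integrable_mul_bridgeKernel_prod (n : ℕ) (i : Fin n) (k l : Fin 2) :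
    Integrable (fun z : (Fin 2 → EuclideanSpace ℝ (Fin n)) × (Fin 2 → ℝ) =>
      z.1 k i * z.1 l i * bridgeKernel n z.2 z.1)
      (volume.prod (volume.restrict (simplex 2))) := by
  refine ((integrable_sq_mul_bridgeKernel_prod n i k).add
    (integrable_sq_mul_bridgeKernel_prod n i l)).mono
    (measurable_mul_bridgeKernel n i k l).aestronglyMeasurable
    (Filter.Eventually.of_forall fun z => ?_)
  simp only [Pi.add_apply, ← add_mul, norm_mul]
  refine mul_le_mul_of_nonneg_right ?_ (norm_nonneg _)
  rw [← norm_mul, Real.norm_eq_abs, Real.norm_eq_abs]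
  refine (abs_le.2 ⟨?_, ?_⟩).trans (le_abs_self _)
  · nlinarith [sq_nonneg (z.1 k i + z.1 l i), sq_nonneg (z.1 k i), sq_nonneg (z.1 l i)]
  · nlinarith [sq_nonneg (z.1 k i - z.1 l i), sq_nonneg (z.1 k i), sq_nonneg (z.1 l i)]

theorem setIntegral_simplex_two {f : ℝ → ℝ → ℝ} (hf : Continuous (Function.uncurry f)) :
    ∫ s in simplex 2, f (s 0) (s 1) = ∫ x in (0 : ℝ)..1, ∫ y in (0 : ℝ)..x, f x y := by
  let T : Set (ℝ × ℝ) := {z | 0 < z.2 ∧ z.2 < z.1 ∧ z.1 < 1}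
  have hmp := volume_preserving_finTwoArrow ℝ
  have hpre : simplex 2 = MeasurableEquiv.finTwoArrow ⁻¹' T := by
    ext s
    exact mem_simplex_two
  have hT : MeasurableSet T := by
    have h := measurableSet_simplex_two
    rwa [hpre, MeasurableEquiv.measurableSet_preimage] at h
  have hint : IntegrableOn (Function.uncurry f) T := by
    rw [← hmp.integrableOn_comp_preimage (MeasurableEquiv.measurableEmbedding _), ← hpre]
    refine integrableOn_simplex_two (hf.comp ?_)
    exact (continuous_apply (0 : Fin 2)).prodMk (continuous_apply (1 : Fin 2))
  have h1 : ∫ s in simplex 2, f (s 0) (s 1) = ∫ z in T, Function.uncurry f z := by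
    rw [hpre, ← hmp.setIntegral_preimage_emb (MeasurableEquiv.measurableEmbedding _)]
    rfl
  rw [h1, ← integral_indicator hT, Measure.volume_eq_prod,
    integral_prod _ ((integrable_indicator_iff hT).2 hint),
    intervalIntegral.integral_of_le zero_le_one, integral_Ioc_eq_integral_Ioo,
    ← integral_indicator measurableSet_Ioo]
  congr 1
  funext x
  by_cases hx : x ∈ Set.Ioo (0 : ℝ) 1
  · rw [Set.indicator_of_mem hx, intervalIntegral.integral_of_le hx.1.le,
      integral_Ioc_eq_integral_Ioo, ← integral_indicator measurableSet_Ioo]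
    congr 1
    funext y
    have : (x, y) ∈ T ↔ y ∈ Set.Ioo 0 x := ⟨fun h => ⟨h.1, h.2.1⟩, fun h => ⟨h.1, h.2, hx.2⟩⟩
    by_cases hy : y ∈ Set.Ioo 0 x
    · rw [Set.indicator_of_mem hy, Set.indicator_of_mem (this.2 hy)]
      rfl
    · rw [Set.indicator_of_notMem hy, Set.indicator_of_notMem (mt this.1 hy)]
  · rw [Set.indicator_of_notMem hx]
    have h0 : ∀ y, T.indicator (Function.uncurry f) (x, y) = 0 := fun y =>
      Set.indicator_of_notMem (fun h => hx ⟨h.1.trans h.2.1, h.2.2⟩) _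
    simp [h0]

theorem integral_bridgeCov (k l : Fin 2) :
    ∫ s in simplex 2, bridgeCov s k l = if k = l then 1 / 6 else 1 / 12 := by
  have h00 := setIntegral_simplex_two (f := fun x _ => 2 * (x * (1 - x))) (by fun_prop)
  have h01 := setIntegral_simplex_two (f := fun x y => 2 * (y * (1 - x))) (by fun_prop)
  have h11 := setIntegral_simplex_two (f := fun _ y => 2 * (y * (1 - y))) (by fun_prop)
  have e00 : ∀ x : ℝ, ∫ _ in (0 : ℝ)..x, 2 * (x * (1 - x)) = 2 * x ^ 2 - 2 * x ^ 3 := by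
    intro x
    rw [intervalIntegral.integral_const, smul_eq_mul]
    ring
  have e01 : ∀ x : ℝ, ∫ y in (0 : ℝ)..x, 2 * (y * (1 - x)) = x ^ 2 - x ^ 3 := by
    intro x
    rw [intervalIntegral.integral_const_mul, intervalIntegral.integral_mul_const, integral_id]
    ring
  have e11 : ∀ x : ℝ, ∫ y in (0 : ℝ)..x, 2 * (y * (1 - y)) = x ^ 2 - 2 / 3 * x ^ 3 := by
    intro x
    simp only [mul_sub, mul_one, ← sq]
    rw [intervalIntegral.integral_sub (Continuous.intervalIntegrable (by fun_prop) _ _)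
      (Continuous.intervalIntegrable (by fun_prop) _ _), intervalIntegral.integral_const_mul,
      intervalIntegral.integral_const_mul, integral_id, integral_pow]
    ring
  have poly : ∀ a b : ℝ, ∫ x in (0 : ℝ)..1, (a * x ^ 2 - b * x ^ 3) = a / 3 - b / 4 := by
    intro a b
    rw [intervalIntegral.integral_sub (Continuous.intervalIntegrable (by fun_prop) _ _)
      (Continuous.intervalIntegrable (by fun_prop) _ _), intervalIntegral.integral_const_mul,
      intervalIntegral.integral_const_mul, integral_pow, integral_pow]
    norm_num
    ring
  have p1 := poly 2 2
  have p2 := poly 1 1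
  have p3 := poly 1 (2 / 3)
  simp only [one_mul] at p2 p3
  simp only [e00, e01, e11, p1, p2, p3] at h00 h01 h11
  fin_cases k <;> fin_cases l <;> simp only [bridgeCov]
  · refine h00.trans ?_
    norm_num
  · refine h01.trans ?_
    norm_num
  · refine h01.trans ?_
    norm_num
  · refine h11.trans ?_
    norm_num

theorem integral_mul_bridgeKernel (n : ℕ) (i : Fin n) (k l : Fin 2) :
    ∫ w : Fin 2 → EuclideanSpace ℝ (Fin n), ∫ s in simplex 2,
      w k i * w l i * bridgeKernel n s w =
      (4 * π) ^ (-(n : ℝ) / 2) * if k = l then 1 / 6 else 1 / 12 := by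
  rw [integral_integral_swap (integrable_mul_bridgeKernel_prod n i k l), ← integral_bridgeCov,
    ← integral_const_mul]
  exact setIntegral_congr_fun measurableSet_simplex_two fun s hs =>
    (integrable_and_integral_mul_bridgeKernel hs i k l).2

theorem cCoeff_one_eq (n : ℕ) (α : Fin 2 → Fin n → ℕ) :
    cCoeff n 1 α = (∏ k, ∏ i, (Nat.factorial (α k i) : ℝ))⁻¹ *
      ∫ w : Fin 2 → EuclideanSpace ℝ (Fin n), ∫ s in simplex 2,
        (∏ k, ∏ i, w k i ^ α k i) * bridgeKernel n s w := by
  simp only [← heatG_mul_prod_fnext]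
  rfl

/-- The pairs of multi-indices of total order two supported on a single coordinate. -/
def axisPair (n : ℕ) (x : Fin n × Fin 3) : Fin 2 → Fin n → ℕ :=
  fun k => Pi.single x.1 ((![![2, 0], ![1, 1], ![0, 2]] : Fin 3 → Fin 2 → ℕ) x.2 k)

theorem cCoeff_axisPair (n : ℕ) (x : Fin n × Fin 3) :
    cCoeff n 1 (axisPair n x) = (4 * π) ^ (-(n : ℝ) / 2) * (1 / 12) := by
  obtain ⟨i, p⟩ := x
  have hfac : ∀ m : ℕ, ∏ j, (Nat.factorial ((Pi.single i m : Fin n → ℕ) j) : ℝ) =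
      Nat.factorial m := by
    intro m
    rw [Finset.prod_eq_single i] <;> simp +contextual
  have hpow : ∀ (m : ℕ) (x : EuclideanSpace ℝ (Fin n)),
      ∏ j, x j ^ (Pi.single i m : Fin n → ℕ) j = x i ^ m := by
    intro m x
    rw [Finset.prod_eq_single i] <;> simp +contextual
  have h00 := integral_mul_bridgeKernel n i 0 0
  have h01 := integral_mul_bridgeKernel n i 0 1
  have h11 := integral_mul_bridgeKernel n i 1 1
  simp only [cCoeff_one_eq, axisPair, hfac, hpow, Fin.prod_univ_two]
  fin_cases p
  · simp [← sq] at h00 ⊢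
    rw [h00]; ring
  · simp at h01 ⊢
    rw [h01]
  · simp [← sq] at h11 ⊢
    rw [h11]; ring

/-- Coefficients with odd total degree in some coordinate vanish by reflection. -/
theorem cCoeff_eq_zero_of_odd {n : ℕ} {α : Fin 2 → Fin n → ℕ} {j : Fin n}
    (hj : Odd (∑ k, α k j)) : cCoeff n 1 α = 0 := by
  let R : EuclideanSpace ℝ (Fin n) ≃ₗᵢ[ℝ] EuclideanSpace ℝ (Fin n) :=
    LinearIsometryEquiv.piLpCongrRight 2
      fun i => if i = j then LinearIsometryEquiv.neg ℝ else LinearIsometryEquiv.refl ℝ ℝ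
  have hR : ∀ x i, R x i = (if i = j then -1 else 1) * x i := by
    intro x i
    simp only [R, LinearIsometryEquiv.piLpCongrRight_apply]
    split_ifs <;> simp
  let Ψ : (Fin 2 → EuclideanSpace ℝ (Fin n)) → (Fin 2 → EuclideanSpace ℝ (Fin n)) :=
    fun w k => R (w k)
  have hΨ : MeasurePreserving Ψ :=
    volume_preserving_pi fun _ => R.measurePreserving
  have hΨe : MeasurableEmbedding Ψ :=
    Continuous.measurableEmbedding (by fun_prop) fun w w' h => by
      funext k
      exact R.injective (congrFun h k)
  have hK : ∀ s w, bridgeKernel n s (Ψ w) = bridgeKernel n s w := by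
    intro s w
    simp only [bridgeKernel, heatG, Ψ, ← map_sub, R.norm_map]
  have hM : ∀ w : Fin 2 → EuclideanSpace ℝ (Fin n),
      ∏ k, ∏ i, Ψ w k i ^ α k i = -∏ k, ∏ i, w k i ^ α k i := by
    intro w
    simp only [Ψ, hR, mul_pow, Finset.prod_mul_distrib]
    have h : ∀ k, ∏ i, (if i = j then (-1 : ℝ) else 1) ^ α k i = (-1) ^ α k j := by
      intro k
      rw [Finset.prod_eq_single j] <;> simp +contextual
    simp only [h, Finset.prod_pow_eq_pow_sum, hj.neg_one_pow]
    ring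
  rw [cCoeff_one_eq]
  have key := hΨ.integral_comp hΨe fun w => ∫ s in simplex 2,
    (∏ k, ∏ i, w k i ^ α k i) * bridgeKernel n s w
  simp only [hK, hM, neg_mul, integral_neg] at key
  rw [self_eq_neg.1 key.symm, mul_zero]

end Coefficients

section Derivatives

theorem foldr_comp_ofFn_eq_id {X : Type*} {n : ℕ} (f : Fin n → X → X) (hf : ∀ j, f j = id) :
    (List.ofFn f).foldr (· ∘ ·) id = id := by
  induction n with
  | zero => simp
  | succ n ih =>
    rw [List.ofFn_succ, List.foldr_cons, ih _ fun j => hf _, hf 0]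
    rfl

theorem foldr_comp_ofFn_eq {X : Type*} {n : ℕ} (f : Fin n → X → X) (i : Fin n)
    (hf : ∀ j, j ≠ i → f j = id) : (List.ofFn f).foldr (· ∘ ·) id = f i := by
  induction n with
  | zero => exact i.elim0
  | succ n ih =>
    rw [List.ofFn_succ, List.foldr_cons]
    induction i using Fin.cases with
    | zero =>
      rw [foldr_comp_ofFn_eq_id _ fun j => hf _ (Fin.succ_ne_zero j)]
      rfl
    | succ i =>
      rw [ih (fun j => f j.succ) i fun j hj => hf _ (by simpa using hj),
        hf 0 (Fin.succ_ne_zero i).symm]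
      rfl

theorem mderiv_single {n : ℕ} (i : Fin n) (m : ℕ) (f : EuclideanSpace ℝ (Fin n) → ℝ) :
    mderiv (Pi.single i m) f = (pderiv1 i)^[m] f := by
  unfold mderiv
  rw [foldr_comp_ofFn_eq _ i fun j hj => by simp [hj]]
  simp

variable {n : ℕ} {f : EuclideanSpace ℝ (Fin n) → ℝ}

theorem contDiff_pderiv1 (i : Fin n) (hf : ContDiff ℝ (⊤ : ℕ∞) f) :
    ContDiff ℝ (⊤ : ℕ∞) (pderiv1 i f) :=
  (hf.fderiv_right (m := (⊤ : ℕ∞)) le_rfl).clm_apply contDiff_const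

theorem hasCompactSupport_pderiv1 (i : Fin n) (hf : HasCompactSupport f) :
    HasCompactSupport (pderiv1 i f) :=
  hf.fderiv_apply ℝ (EuclideanSpace.single i 1)

theorem integral_mul_pderiv1_pderiv1 (i : Fin n) (hf : ContDiff ℝ (⊤ : ℕ∞) f)
    (hc : HasCompactSupport f) :
    ∫ x, f x * pderiv1 i (pderiv1 i f) x = -∫ x, pderiv1 i f x ^ 2 := by
  have h1 := contDiff_pderiv1 i hf
  have h2 := contDiff_pderiv1 i h1
  have c1 := hasCompactSupport_pderiv1 i hc
  simp only [sq]
  exact integral_mul_fderiv_eq_neg_fderiv_mul_of_integrable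
    ((h1.continuous.mul h1.continuous).integrable_of_hasCompactSupport c1.mul_left)
    ((hf.continuous.mul h2.continuous).integrable_of_hasCompactSupport hc.mul_right)
    ((hf.continuous.mul h1.continuous).integrable_of_hasCompactSupport hc.mul_right)
    (fun x _ => hf.differentiable (by simp) x) (fun x _ => h1.differentiable (by simp) x)

theorem pderiv1_eq_zero_of_notMem_tsupport (i : Fin n) {x : EuclideanSpace ℝ (Fin n)}
    (hx : x ∉ tsupport f) : pderiv1 i f x = 0 := by
  have : fderiv ℝ f x = 0 := by
    by_contra h
    exact hx (support_fderiv_subset ℝ h)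
  simp [pderiv1, this]

theorem setIntegral_mul_pderiv1_pderiv1 (i : Fin n) {Ω : Set (EuclideanSpace ℝ (Fin n))}
    (hf : ContDiff ℝ (⊤ : ℕ∞) f) (hc : HasCompactSupport f) (hΩ : tsupport f ⊆ Ω) :
    ∫ x in Ω, f x * pderiv1 i (pderiv1 i f) x = -∫ x in Ω, pderiv1 i f x ^ 2 := by
  rw [setIntegral_eq_integral_of_forall_compl_eq_zero,
    setIntegral_eq_integral_of_forall_compl_eq_zero, integral_mul_pderiv1_pderiv1 i hf hc]
  · intro x hx
    rw [pderiv1_eq_zero_of_notMem_tsupport i fun h => hx (hΩ h), zero_pow two_ne_zero]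
  · intro x hx
    rw [image_eq_zero_of_notMem_tsupport fun h => hx (hΩ h), zero_mul]

theorem Pcoef_axisPair (Ω : Set (EuclideanSpace ℝ (Fin n))) (hf : ContDiff ℝ (⊤ : ℕ∞) f)
    (hc : HasCompactSupport f) (hΩ : tsupport f ⊆ Ω) (x : Fin n × Fin 3) :
    Pcoef n 1 Ω (axisPair n x) f =
      (![-1, 1, -1] : Fin 3 → ℝ) x.2 * ∫ y in Ω, pderiv1 x.1 f y ^ 2 := by
  obtain ⟨i, p⟩ := x
  have h := setIntegral_mul_pderiv1_pderiv1 i hf hc hΩ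
  simp only [Pcoef, axisPair, mderiv_single]
  fin_cases p
  · simpa [mul_comm] using h
  · simp [sq]
  · simpa using h

end Derivatives

section Indices

theorem injective_axisPair (n : ℕ) : Function.Injective (axisPair n) := by
  rintro ⟨i, p⟩ ⟨j, q⟩ h
  have h0 := congrFun (congrFun h 0) i
  have h1 := congrFun (congrFun h 1) i
  by_cases hij : i = j
  · subst hij
    simp only [axisPair, Pi.single_eq_same] at h0 h1
    fin_cases p <;> fin_cases q <;> simp_all
  · simp only [axisPair, Pi.single_eq_same, Pi.single_eq_of_ne hij] at h0 h1
    fin_cases p <;> simp_all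

theorem sum_axisPair (n : ℕ) (x : Fin n × Fin 3) : ∑ k, ∑ i, axisPair n x k i = 2 := by
  obtain ⟨i, p⟩ := x
  simp only [axisPair, Fin.sum_univ_two, Finset.sum_pi_single', Finset.mem_univ, if_true]
  fin_cases p <;> rfl

theorem exists_odd_or_mem_range_axisPair {n : ℕ} {α : Fin 2 → Fin n → ℕ}
    (hα : ∑ k, ∑ i, α k i = 2) :
    (∃ j, Odd (∑ k, α k j)) ∨ α ∈ Set.range (axisPair n) := by
  by_contra! hcon
  obtain ⟨hodd, hrange⟩ := hcon
  simp only [Nat.not_odd_iff_even, Fin.sum_univ_two] at hodd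
  rw [Fin.sum_univ_two, ← Finset.sum_add_distrib] at hα
  obtain ⟨i, -, hi⟩ : ∃ i ∈ Finset.univ, α 0 i + α 1 i ≠ 0 :=
    Finset.exists_ne_zero_of_sum_ne_zero (by omega)
  have hsplit := Finset.add_sum_erase Finset.univ (fun i => α 0 i + α 1 i) (Finset.mem_univ i)
  obtain ⟨m, hm⟩ := hodd i
  have hi2 : α 0 i + α 1 i = 2 := by omega
  have hrest : ∑ j ∈ Finset.univ.erase i, (α 0 j + α 1 j) = 0 := by omega
  have hz : ∀ j, j ≠ i → α 0 j = 0 ∧ α 1 j = 0 := by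
    intro j hj
    have := Finset.sum_eq_zero_iff.1 hrest j (by simp [hj])
    omega
  have hform : ∀ p : Fin 3, (∀ k, α k i = (![![2, 0], ![1, 1], ![0, 2]] : Fin 3 → Fin 2 → ℕ) p k) →
      axisPair n (i, p) = α := by
    intro p hp
    funext k j
    by_cases hj : j = i
    · subst hj
      simp [axisPair, hp]
    · have := hz j hj
      fin_cases k <;> simp_all [axisPair]
  have h3 : (α 0 i = 2 ∧ α 1 i = 0) ∨ (α 0 i = 1 ∧ α 1 i = 1) ∨ (α 0 i = 0 ∧ α 1 i = 2) := by
    omega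
  rcases h3 with h | h | h
  · exact hrange ⟨(i, 0), hform 0 (by simp [Fin.forall_fin_two, h])⟩
  · exact hrange ⟨(i, 1), hform 1 (by simp [Fin.forall_fin_two, h])⟩
  · exact hrange ⟨(i, 2), hform 2 (by simp [Fin.forall_fin_two, h])⟩

end Indices

theorem sum_cP_order_two (n : ℕ) (Ω : Set (EuclideanSpace ℝ (Fin n)))
    (hΩ : IsOpen Ω) (hbdd : Bornology.IsBounded Ω)
    (V : EuclideanSpace ℝ (Fin n) → ℝ) (hV : ContDiff ℝ (⊤ : ℕ∞) V)
    (hcpt : HasCompactSupport V) (hsupp : tsupport V ⊆ Ω) :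
    (4 * Real.pi) ^ ((n : ℝ) / 2) *
      ∑' α : Fin 2 → Fin n → ℕ,
        (if (∑ k, ∑ i, α k i) = 2 then cCoeff n 1 α * Pcoef n 1 Ω α V else 0) =
    -(1 / 12) * ∫ x in Ω, ∑ i, pderiv1 i V x ^ 2 := by
  have hsub : Function.support (fun α : Fin 2 → Fin n → ℕ =>
      if (∑ k, ∑ i, α k i) = 2 then cCoeff n 1 α * Pcoef n 1 Ω α V else 0) ⊆
      Set.range (axisPair n) := by
    intro α hα
    rw [Function.mem_support] at hα
    obtain ⟨h2, hne⟩ := ite_ne_right_iff.1 hα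
    rcases exists_odd_or_mem_range_axisPair h2 with ⟨j, hj⟩ | h
    · rw [cCoeff_eq_zero_of_odd hj, zero_mul] at hne
      exact absurd rfl hne
    · exact h
  have hint : ∀ i : Fin n, Integrable (fun x => pderiv1 i V x ^ 2) (volume.restrict Ω) := by
    intro i
    have h1 := (contDiff_pderiv1 i hV).continuous
    simp only [sq]
    exact ((h1.mul h1).integrable_of_hasCompactSupport
      (hasCompactSupport_pderiv1 i hcpt).mul_left).restrict
  have hπ : (4 * π) ^ ((n : ℝ) / 2) * (4 * π) ^ (-(n : ℝ) / 2) = 1 := by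
    rw [← Real.rpow_add (by positivity), neg_div, add_neg_cancel, Real.rpow_zero]
  rw [← (injective_axisPair n).tsum_eq hsub, tsum_fintype, Fintype.sum_prod_type,
    integral_finsetSum _ fun i _ => hint i]
  simp only [sum_axisPair, if_true, cCoeff_axisPair, Pcoef_axisPair Ω hV hcpt hsupp]
  rw [Finset.mul_sum, Finset.mul_sum]
  refine Finset.sum_congr rfl fun i _ => ?_
  simp only [Fin.sum_univ_three, Matrix.cons_val]
  linear_combination (-(1 / 12) * ∫ x in Ω, pderiv1 i V x ^ 2) * hπ
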